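/- Let 𝒦ⁿ be the set of convex bodies in ℝⁿ equipped with the Hausdorff metric. Then the map K ↦ max{ det T : T ∈ S₊, T B₂ⁿ ⊆ K } is continuous on 𝒦ⁿ (with the convention that the maximum is taken over a possibly empty set which occurs only when 0 ∉ int K). Moreover, for K with 0 ∈ int K, if T_K ∈ S₊ attains this maximum, then T_K is unique up to composition with an orthogonal transformation. -/

import Mathlib

open MeasureTheory Metric Set

noncomputable section

abbrev En (n : ℕ) := EuclideanSpace ℝ (Fin n)

/-- The set of determinants of symmetric positive definite `T` with `T B₂ⁿ ⊆ K`. -/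
def detSet {n : ℕ} (K : Set (En n)) : Set ℝ :=
  {d : ℝ | ∃ T : Matrix (Fin n) (Fin n) ℝ, T.PosDef ∧
    Matrix.toEuclideanLin T '' closedBall (0 : En n) 1 ⊆ K ∧ d = T.det}

open Matrix in
open scoped MatrixOrder in
lemma Matrix.PosDef.exists_eq_conjTranspose_mul_self {ι : Type*} [Fintype ι] [DecidableEq ι]
    {A : Matrix ι ι ℝ} (hA : A.PosDef) :
    ∃ C : Matrix ι ι ℝ, IsUnit C ∧ A = Cᴴ * C := by
  obtain ⟨C, hC⟩ := CStarAlgebra.nonneg_iff_eq_star_mul_self.mp hA.posSemidef.nonneg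
  refine ⟨C, ?_, hC⟩
  rw [Matrix.isUnit_iff_isUnit_det, isUnit_iff_ne_zero]
  intro h
  have := hA.det_pos
  rw [hC, Matrix.det_mul, h, mul_zero] at this
  exact this.false

open Matrix in
/-- A positive definite `M` with `det M = 1` and `det ((1 + M) / 2) ≤ 1` is the identity. -/
lemma Matrix.PosDef.eq_one_of_det_half_add_le {ι : Type*} [Fintype ι] [DecidableEq ι]
    {M : Matrix ι ι ℝ} (hM : M.PosDef) (hdet : M.det = 1)
    (hle : ((1 / 2 : ℝ) • (1 + M)).det ≤ 1) : M = 1 := by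
  set μ := hM.isHermitian.eigenvalues
  have hpos : ∀ i, 0 < μ i := hM.eigenvalues_pos
  have hspec := hM.isHermitian.spectral_theorem
  set U := hM.isHermitian.eigenvectorUnitary
  have hprod : ∏ i, μ i = 1 := by
    rw [← hdet, hM.isHermitian.det_eq_prod_eigenvalues]; rfl
  have hhalf : ((1 / 2 : ℝ) • (1 + M)).det = ∏ i, (1 + μ i) / 2 := by
    have h1 : (1 / 2 : ℝ) • (1 + M) =
        Unitary.conjStarAlgAut ℝ _ U (diagonal fun i => (1 + μ i) / 2) := by
      have h2 : (diagonal fun i => (1 + μ i) / 2) =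
          (1 / 2 : ℝ) • (1 + diagonal (RCLike.ofReal ∘ μ) : Matrix ι ι ℝ) := by
        ext i j
        by_cases hij : i = j
        · subst hij; simp; ring
        · simp [hij]
      rw [h2, map_smul, map_add, map_one, ← hspec]
    rw [h1, Unitary.conjStarAlgAut_apply, det_mul_right_comm]
    simp
  have hall : ∀ i, μ i = 1 := by
    by_contra! hne
    obtain ⟨i, hi⟩ := hne
    have hlt : ∏ i, μ i < ∏ i, ((1 + μ i) / 2) ^ 2 := by
      refine Finset.prod_lt_prod (fun i _ => hpos i)
        (fun i _ => by nlinarith [sq_nonneg (μ i - 1)]) ⟨i, Finset.mem_univ i, ?_⟩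
      nlinarith [sq_pos_of_ne_zero (sub_ne_zero.mpr hi)]
    rw [hprod, Finset.prod_pow, ← hhalf] at hlt
    have h0 : 0 ≤ ((1 / 2 : ℝ) • (1 + M)).det := by
      rw [hhalf]
      exact Finset.prod_nonneg fun i _ => by linarith [hpos i]
    nlinarith
  have hd : (diagonal (RCLike.ofReal ∘ μ) : Matrix ι ι ℝ) = 1 := by
    rw [← diagonal_one]
    congr 1
    funext i
    simp [hall i]
  rw [hspec, hd, map_one]

open Matrix in
/-- The equality case of the log-concavity of the determinant at the midpoint. -/
lemma Matrix.PosDef.eq_of_det_midpoint_le {ι : Type*} [Fintype ι] [DecidableEq ι]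
    {A B : Matrix ι ι ℝ} (hA : A.PosDef) (hB : B.PosDef) (hdet : A.det = B.det)
    (hle : ((1 / 2 : ℝ) • (A + B)).det ≤ A.det) : A = B := by
  obtain ⟨C, hC, rfl⟩ := hA.exists_eq_conjTranspose_mul_self
  have hCdet : IsUnit C.det := (Matrix.isUnit_iff_isUnit_det C).mp hC
  have hCdet' : IsUnit Cᴴ.det := by simpa using hCdet
  set M := C⁻¹ᴴ * B * C⁻¹ with hMdef
  have hM : M.PosDef := by
    refine hB.conjTranspose_mul_mul_same (mulVec_injective_of_isUnit ?_)
    exact (Matrix.isUnit_nonsing_inv_iff).mpr hC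
  have hBM : B = Cᴴ * M * C := by
    rw [hMdef, conjTranspose_nonsing_inv]
    simp only [mul_assoc]
    rw [nonsing_inv_mul C hCdet, mul_one, mul_nonsing_inv_cancel_left _ _ hCdet']
  have hne : (Cᴴ * C).det ≠ 0 := hA.det_pos.ne'
  have hM1 : M.det = 1 := by
    have : (Cᴴ * C).det * M.det = (Cᴴ * C).det * 1 := by
      rw [mul_one]
      conv_rhs => rw [hdet, hBM]
      simp only [det_mul]; ring
    exact mul_left_cancel₀ hne this
  have hMle : ((1 / 2 : ℝ) • (1 + M)).det ≤ 1 := by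
    have h1 : (1 / 2 : ℝ) • (Cᴴ * C + B) = Cᴴ * ((1 / 2 : ℝ) • (1 + M)) * C := by
      conv_lhs => rw [hBM]
      simp [mul_add, add_mul]
    have h2 : (Cᴴ * C).det * ((1 / 2 : ℝ) • (1 + M)).det ≤ (Cᴴ * C).det * 1 := by
      rw [mul_one]
      refine le_trans (le_of_eq ?_) hle
      rw [h1]
      simp only [det_mul]; ring
    exact le_of_mul_le_mul_left h2 hA.det_pos
  rw [hM.eq_one_of_det_half_add_le hM1 hMle, mul_one] at hBM
  exact hBM.symm

/-- If `E` contains the ball of radius `r` and lies within distance `s * r` of the closed convex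
set `K`, then `(1 - s) • E ⊆ K`. -/
lemma Convex.one_sub_smul_mem_of_forall_exists_dist_le {V : Type*} [NormedAddCommGroup V]
    [InnerProductSpace ℝ V] [CompleteSpace V] {E K : Set V} (hE : Convex ℝ E) (hK : Convex ℝ K)
    (hKc : IsClosed K) {r s : ℝ} (hr : 0 ≤ r) (hs0 : 0 ≤ s) (hs1 : s ≤ 1)
    (hball : closedBall (0 : V) r ⊆ E) (hnear : ∀ p ∈ E, ∃ k ∈ K, dist p k ≤ s * r)
    {x : V} (hx : x ∈ E) : (1 - s) • x ∈ K := by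
  by_contra hy
  obtain ⟨f, u, hfK, hfy⟩ := geometric_hahn_banach_closed_point hK hKc hy
  obtain ⟨v, rfl⟩ := (InnerProductSpace.toDual ℝ V).surjective f
  simp only [InnerProductSpace.toDual_apply_apply] at hfK hfy
  set z : V := (‖v‖)⁻¹ • v with hz
  have hz1 : ‖z‖ ≤ 1 := by
    rw [hz, norm_smul, norm_inv, norm_norm]
    exact inv_mul_le_one
  have hvz : inner ℝ v z = ‖v‖ := by
    rw [hz, inner_smul_right, real_inner_self_eq_norm_sq]
    by_cases h : ‖v‖ = 0
    · simp [h]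
    · field_simp
  have hrz : r • z ∈ E := by
    apply hball
    rw [mem_closedBall_zero_iff, norm_smul, Real.norm_of_nonneg hr]
    nlinarith
  have hp : (1 - s) • x + s • r • z ∈ E := hE hx hrz (by linarith) hs0 (by ring)
  obtain ⟨k, hk, hd⟩ := hnear _ hp
  have h1 : inner ℝ v ((1 - s) • x + s • r • z - k) ≤ ‖v‖ * (s * r) := by
    refine (real_inner_le_norm _ _).trans ?_
    rw [dist_eq_norm] at hd
    exact mul_le_mul_of_nonneg_left hd (norm_nonneg _)
  rw [inner_sub_right, inner_add_right, inner_smul_right v (r • z), inner_smul_right v z, hvz] at h1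
  have h2 := hfK k hk
  linarith

/-- Matrices mapping the unit ball into a ball of radius `R` have bounded entries. -/
lemma entry_mem_Icc_of_image_closedBall_subset {n : ℕ} {T : Matrix (Fin n) (Fin n) ℝ} {R : ℝ}
    (hT : Matrix.toEuclideanLin T '' closedBall (0 : En n) 1 ⊆ closedBall 0 R) (i j : Fin n) :
    T i j ∈ Icc (-R) R := by
  have h := hT ⟨EuclideanSpace.single j 1, by simp, rfl⟩
  rw [mem_closedBall_zero_iff] at h
  have h2 := (PiLp.norm_apply_le _ i).trans h
  rw [Matrix.toLpLin_apply] at h2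
  simpa [abs_le] using h2

/-- Uniform bounds on the determinant and the adjugate of the admissible matrices. -/
lemma exists_det_adjugate_bound (n : ℕ) (R : ℝ) :
    ∃ C : ℝ, 0 < C ∧ ∀ T : Matrix (Fin n) (Fin n) ℝ,
      Matrix.toEuclideanLin T '' closedBall (0 : En n) 1 ⊆ closedBall 0 R →
      T.det ≤ C ∧ ∀ y : En n, ‖Matrix.toEuclideanLin T.adjugate y‖ ≤ C * ‖y‖ := by
  let S : Set (Matrix (Fin n) (Fin n) ℝ) := Set.pi univ fun _ => Set.pi univ fun _ => Icc (-R) R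
  have hS : IsCompact S := isCompact_univ_pi fun _ => isCompact_univ_pi fun _ => isCompact_Icc
  have hdet : Continuous fun T : Matrix (Fin n) (Fin n) ℝ => T.det := continuous_id.matrix_det
  have hcl : Continuous fun T : Matrix (Fin n) (Fin n) ℝ =>
      Matrix.toEuclideanCLM (n := Fin n) (𝕜 := ℝ) T :=
    LinearMap.continuous_of_finiteDimensional
      (Matrix.toEuclideanCLM (n := Fin n) (𝕜 := ℝ)).toAlgEquiv.toLinearMap
  have hadj : Continuous fun T : Matrix (Fin n) (Fin n) ℝ =>
      Matrix.toEuclideanCLM (n := Fin n) (𝕜 := ℝ) T.adjugate :=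
    hcl.comp continuous_id.matrix_adjugate
  obtain ⟨C₁, h₁⟩ := hS.exists_bound_of_continuousOn hdet.continuousOn
  obtain ⟨C₂, h₂⟩ := hS.exists_bound_of_continuousOn hadj.continuousOn
  refine ⟨max 1 (max C₁ C₂), by positivity, fun T hT => ?_⟩
  have hTS : T ∈ S := fun i _ j _ => entry_mem_Icc_of_image_closedBall_subset hT i j
  refine ⟨(le_abs_self _).trans ((h₁ T hTS).trans (by simp)), fun y => ?_⟩
  refine ((Matrix.toEuclideanCLM (n := Fin n) (𝕜 := ℝ) T.adjugate).le_opNorm y).trans ?_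
  exact mul_le_mul_of_nonneg_right ((h₂ T hTS).trans (by simp)) (norm_nonneg _)

lemma closedBall_subset_image_of_adjugate_bound {n : ℕ} {T : Matrix (Fin n) (Fin n) ℝ} {c C : ℝ}
    (hc : 0 < c) (hC : 0 < C) (hdet : c ≤ T.det)
    (hadj : ∀ y : En n, ‖Matrix.toEuclideanLin T.adjugate y‖ ≤ C * ‖y‖) :
    closedBall (0 : En n) (c / C) ⊆ Matrix.toEuclideanLin T '' closedBall (0 : En n) 1 := by
  intro y hy
  rw [mem_closedBall_zero_iff] at hy
  have hd : 0 < T.det := hc.trans_le hdet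
  refine ⟨T.det⁻¹ • Matrix.toEuclideanLin T.adjugate y, ?_, ?_⟩
  · rw [mem_closedBall_zero_iff, norm_smul, norm_inv, Real.norm_of_nonneg hd.le,
      inv_mul_le_iff₀ hd, mul_one]
    refine (hadj y).trans (le_trans ?_ hdet)
    rwa [le_div_iff₀' hC] at hy
  · rw [map_smul, Matrix.toLpLin_apply, Matrix.toLpLin_apply, WithLp.ofLp_toLp,
      Matrix.mulVec_mulVec, Matrix.mul_adjugate, Matrix.smul_mulVec, Matrix.one_mulVec,
      WithLp.toLp_smul, WithLp.toLp_ofLp, inv_smul_smul₀ hd.ne']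

lemma bddAbove_detSet {n : ℕ} (K : ConvexBody (En n)) : BddAbove (detSet (K : Set (En n))) := by
  obtain ⟨R, hR⟩ := K.isBounded.subset_closedBall (0 : En n)
  obtain ⟨C, -, hC⟩ := exists_det_adjugate_bound n R
  refine ⟨C, ?_⟩
  rintro d ⟨T, -, hT, rfl⟩
  exact (hC T (hT.trans hR)).1

lemma sSup_detSet_nonneg {n : ℕ} (K : Set (En n)) : 0 ≤ sSup (detSet K) := by
  refine Real.sSup_nonneg ?_
  rintro d ⟨T, hT, -, rfl⟩
  exact hT.det_pos.le

/-- Uniform lower semicontinuity of the maximal determinant on bounded families of bodies. -/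
lemma exists_sSup_detSet_sub_le (n : ℕ) (R : ℝ) {ε : ℝ} (hε : 0 < ε) :
    ∃ δ > 0, ∀ K L : ConvexBody (En n), (K : Set (En n)) ⊆ closedBall 0 R → dist K L < δ →
      sSup (detSet (K : Set (En n))) - ε ≤ sSup (detSet (L : Set (En n))) := by
  obtain ⟨C, hC, hbound⟩ := exists_det_adjugate_bound n R
  set s : ℝ := min (1 / 2) (ε / ((n + 1) * C)) with hs
  have hs0 : 0 < s := by positivity
  have hs1 : s ≤ 1 / 2 := min_le_left _ _
  have hsn : n * s * C ≤ ε := by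
    have : s * ((n + 1) * C) ≤ ε := (le_div_iff₀ (by positivity)).mp (min_le_right _ _)
    nlinarith [mul_pos hs0 hC]
  refine ⟨s * (ε / C), by positivity, fun K L hK hKL => ?_⟩
  rw [sub_le_iff_le_add]
  refine Real.sSup_le ?_ (add_nonneg (sSup_detSet_nonneg _) hε.le)
  rintro d ⟨T, hT, hTK, rfl⟩
  obtain hd | hd := le_total T.det ε
  · linarith [sSup_detSet_nonneg (L : Set (En n))]
  obtain ⟨hTC, hadj⟩ := hbound T (hTK.trans hK)
  have hball := closedBall_subset_image_of_adjugate_bound hε hC hd hadj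
  have hmem : (1 - s) ^ n * T.det ∈ detSet (L : Set (En n)) := by
    refine ⟨(1 - s) • T, hT.smul (by linarith), ?_, by simp⟩
    rintro _ ⟨x, hx, rfl⟩
    rw [map_smul, LinearMap.smul_apply]
    refine Convex.one_sub_smul_mem_of_forall_exists_dist_le
      ((convex_closedBall _ _).linear_image _) L.convex L.isClosed (by positivity) hs0.le
      (by linarith) hball (fun p hp => ?_) (mem_image_of_mem _ hx)
    obtain ⟨k, hk, hpk⟩ := exists_dist_lt_of_hausdorffDist_lt (hTK hp) hKL
      ConvexBody.hausdorffEDist_ne_top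
    exact ⟨k, hk, hpk.le⟩
  have hle := le_csSup (bddAbove_detSet L) hmem
  have hbern : 1 + n * (-s) ≤ (1 + -s) ^ n := one_add_mul_le_pow (by linarith) n
  rw [← sub_eq_add_neg] at hbern
  have h1 : (1 + n * (-s)) * T.det ≤ (1 - s) ^ n * T.det :=
    mul_le_mul_of_nonneg_right hbern hT.det_pos.le
  have h2 : n * s * T.det ≤ n * s * C := mul_le_mul_of_nonneg_left hTC (by positivity)
  nlinarith

lemma continuous_sSup_detSet (n : ℕ) :
    Continuous fun K : ConvexBody (En n) => sSup (detSet (K : Set (En n))) := by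
  rw [Metric.continuous_iff]
  intro K ε hε
  obtain ⟨R, hR⟩ := K.isBounded.subset_closedBall (0 : En n)
  obtain ⟨δ, hδ, h⟩ := exists_sSup_detSet_sub_le n (R + 1) (half_pos hε)
  refine ⟨min δ 1, by positivity, fun L hL => ?_⟩
  have hLδ : dist L K < δ := hL.trans_le (min_le_left _ _)
  have hLR : (L : Set (En n)) ⊆ closedBall 0 (R + 1) := by
    intro x hx
    obtain ⟨k, hk, hxk⟩ := exists_dist_lt_of_hausdorffDist_lt hx (hL.trans_le (min_le_right _ _))
      ConvexBody.hausdorffEDist_ne_top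
    have := mem_closedBall.mp (hR hk)
    rw [mem_closedBall]
    linarith [dist_triangle x k 0]
  have h1 := h L K hLR hLδ
  have h2 := h K L (hR.trans (closedBall_subset_closedBall (by linarith))) (by rwa [dist_comm])
  rw [Real.dist_eq, abs_lt]
  constructor <;> linarith

/-- the map `K ↦ max{det T : T ∈ S₊, TB₂ⁿ ⊆ K}` is continuous on the
space of convex bodies with the Hausdorff metric, and for `K` with `0 ∈ int K` the
maximizer is unique up to composition with an orthogonal transformation. -/
theorem det_max_continuous_and_maximizer_unique {n : ℕ} :
    Continuous (fun K : ConvexBody (En n) => sSup (detSet (K : Set (En n)))) ∧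
    (∀ K : ConvexBody (En n), (0 : En n) ∈ interior (K : Set (En n)) →
      ∀ T₁ T₂ : Matrix (Fin n) (Fin n) ℝ, T₁.PosDef → T₂.PosDef →
        Matrix.toEuclideanLin T₁ '' closedBall (0 : En n) 1 ⊆ (K : Set (En n)) →
        Matrix.toEuclideanLin T₂ '' closedBall (0 : En n) 1 ⊆ (K : Set (En n)) →
        T₁.det = sSup (detSet (K : Set (En n))) →
        T₂.det = sSup (detSet (K : Set (En n))) →
        ∃ O ∈ Matrix.orthogonalGroup (Fin n) ℝ, T₂ = T₁ * O) := by
  refine ⟨continuous_sSup_detSet n, fun K _ T₁ T₂ hT₁ hT₂ hK₁ hK₂ hd₁ hd₂ => ?_⟩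
  refine ⟨1, one_mem _, ?_⟩
  rw [mul_one]
  refine (hT₁.eq_of_det_midpoint_le hT₂ (hd₁.trans hd₂.symm) ?_).symm
  rw [hd₁]
  refine le_csSup (bddAbove_detSet K)
    ⟨(1 / 2 : ℝ) • (T₁ + T₂), (hT₁.add hT₂).smul (by norm_num), ?_, rfl⟩
  rintro _ ⟨x, hx, rfl⟩
  rw [map_smul, map_add, LinearMap.smul_apply, LinearMap.add_apply, smul_add]
  exact K.convex (hK₁ (mem_image_of_mem _ hx)) (hK₂ (mem_image_of_mem _ hx))
    (by norm_num) (by norm_num) (by norm_num)
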